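/- For any finite simplicial complex K and any r ≥ 0 and n ≥ 2, the n-th symmetric topological complexity of the geometric realization satisfies TC^Σ_n(|K|) ≤ SC^{Σ,r}_n(K). -/

import Mathlib

noncomputable section
open scoped ENat
attribute [local instance] Classical.propDecidable

universe u v

/-! ### The wedge `I_n` of `n` unit intervals glued at `0` -/

def wedgeSetoid (n : ℕ) : Setoid (Fin n × unitInterval) where
  r p q := p = q ∨ (p.2 = 0 ∧ q.2 = 0)
  iseqv := by
    refine ⟨fun _ => Or.inl rfl, ?_, ?_⟩
    · rintro p q (rfl | ⟨h1, h2⟩)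
      · exact Or.inl rfl
      · exact Or.inr ⟨h2, h1⟩
    · rintro p q s (rfl | ⟨h1, h2⟩) h
      · exact h
      · rcases h with rfl | ⟨h3, h4⟩
        · exact Or.inr ⟨h1, h2⟩
        · exact Or.inr ⟨h1, h4⟩

def WedgeI (n : ℕ) : Type := Quotient (wedgeSetoid n)

instance (n : ℕ) : TopologicalSpace (WedgeI n) := by unfold WedgeI; infer_instance

/-- the point `t_j` on the `j`-th arm of `I_n`. -/
def arm (n : ℕ) (j : Fin n) (t : unitInterval) : WedgeI n :=
  Quotient.mk (wedgeSetoid n) (j, t)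

/-- The `n`-th symmetric topological complexity `TC^Σ_n(X)`:  the equivariant sectional
category of the fibration `e_n : X^{I_n} → X^n`. -/
def TCSigma (n : ℕ) (X : Type v) [TopologicalSpace X] : ℕ∞ :=
  sInf {k : ℕ∞ | ∃ k0 : ℕ, k = (k0 : ℕ∞) ∧
    ∃ U : Fin k0 → Set (Fin n → X),
      (∀ i, IsOpen (U i)) ∧
      (∀ x, ∃ i, x ∈ U i) ∧
      (∀ i (g : Equiv.Perm (Fin n)), ∀ x ∈ U i, (fun j => x (g j)) ∈ U i) ∧
      ∀ i, ∃ s : C(↥(U i), C(WedgeI n, X)),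
        (∀ (x : ↥(U i)) (j : Fin n), (s x) (arm n j 1) = x.1 j) ∧
        ∀ (g : Equiv.Perm (Fin n)) (x : Fin n → X) (hx : x ∈ U i)
          (hgx : (fun j => x (g j)) ∈ U i) (t : unitInterval) (j : Fin n),
          (s ⟨fun j => x (g j), hgx⟩) (arm n j t) = (s ⟨x, hx⟩) (arm n (g j) t)}

/-! ### Abstract simplicial complexes, simplicial maps and contiguity -/

structure ASC (V : Type u) where
  faces : Set (Finset V)
  nonempty_of_mem : ∀ {σ : Finset V}, σ ∈ faces → σ.Nonempty
  down_closed : ∀ {σ τ : Finset V}, σ ∈ faces → τ ⊆ σ → τ.Nonempty → τ ∈ faces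

def IsSimplicialMap {V : Type u} {W : Type v} (K : ASC V) (L : ASC W) (f : V → W) : Prop :=
  ∀ σ ∈ K.faces, σ.image f ∈ L.faces

/-- one-step contiguity (of simplicial maps). -/
def OneCont {V : Type u} {W : Type v} (K : ASC V) (L : ASC W) (f g : V → W) : Prop :=
  IsSimplicialMap K L f ∧ IsSimplicialMap K L g ∧
    ∀ σ ∈ K.faces, σ.image f ∪ σ.image g ∈ L.faces

/-- `c`-contiguity. -/
def Contig {V : Type u} {W : Type v} (K : ASC V) (L : ASC W) (c : ℕ) (f g : V → W) : Prop :=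
  ∃ φ : ℕ → V → W, φ 0 = f ∧ φ c = g ∧ ∀ i < c, OneCont K L (φ i) (φ (i + 1))

/-- `v` is a vertex of `K`. -/
def vertexOf {V : Type u} (K : ASC V) (v : V) : Prop := {v} ∈ K.faces

/-- Symmetric contiguity of the family `f_1, …, f_n : K → L` relative to an action `act` of
`Σ_n` on the vertices of `K`. -/
def SymContiguousOn {V : Type u} {W : Type v} (n : ℕ) (act : Equiv.Perm (Fin n) → V → V)
    (K : ASC V) (L : ASC W) (f : Fin n → V → W) : Prop :=
  (∀ (j : Fin n) (g : Equiv.Perm (Fin n)) (v : V), vertexOf K v → f j (act g v) = f (g j) v) ∧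
  ∃ (c : ℕ) (φ : Fin n → ℕ → V → W), 0 < c ∧
    (∀ j j', φ j 0 = φ j' 0) ∧
    (∀ (j : Fin n) (g : Equiv.Perm (Fin n)) (v : V), vertexOf K v → φ j 0 (act g v) = φ j 0 v) ∧
    (∀ j, φ j c = f j) ∧
    (∀ j l, l < c → OneCont K L (φ j l) (φ j (l + 1))) ∧
    (∀ (j : Fin n) (l : ℕ) (g : Equiv.Perm (Fin n)) (v : V),
      vertexOf K v → l ≤ c → φ j l (act g v) = φ (g j) l v)
/-! ### Geometric realization -/

def ASC.realization {V : Type u} [Fintype V] (K : ASC V) : Set (V → ℝ) :=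
  {α | (∀ v, 0 ≤ α v) ∧ (∑ v, α v) = 1 ∧ ∃ σ ∈ K.faces, ∀ v, α v ≠ 0 → v ∈ σ}

/-- the open star of a vertex in the realization. -/
def ASC.star {V : Type u} [Fintype V] (K : ASC V) (v : V) : Set (V → ℝ) :=
  {α | α ∈ K.realization ∧ α v ≠ 0}

/-- realization of a vertex map (pushforward of weights). -/
def realizeMap {V : Type u} {W : Type v} [Fintype V] (f : V → W) (α : V → ℝ) : W → ℝ :=
  fun w => ∑ v ∈ Finset.univ.filter (fun v => f v = w), α v

/-! ### Barycentric subdivision of a simplicial complex -/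

/-- the barycentric subdivision: vertices are the simplices of `K`, simplices are chains. -/
def sdC {W : Type u} (K : ASC W) : ASC (Finset W) where
  faces := {c | c.Nonempty ∧ (∀ σ ∈ c, σ ∈ K.faces) ∧ IsChain (· ⊆ ·) (c : Set (Finset W))}
  nonempty_of_mem h := h.1
  down_closed := by
    intro σ τ hσ hsub hne
    exact ⟨hne, fun x hx => hσ.2.1 x (hsub hx), hσ.2.2.mono (Finset.coe_subset.mpr hsub)⟩

/-- the canonical linear map `|sd K| → |K|` sending the vertex `σ` to the barycenter of `σ`. -/
def stepReal (W : Type u) [Fintype W] (β : Finset W → ℝ) : W → ℝ :=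
  fun w => ∑ σ : Finset W, β σ * (if w ∈ σ then ((σ.card : ℝ))⁻¹ else 0)

/-! ### Order complexes, products, lower-set (Alexandrov) topologies -/

/-- the order complex of a poset: simplices are finite nonempty chains. -/
def OC (P : Type u) [Preorder P] : ASC P where
  faces := {σ | σ.Nonempty ∧ IsChain (· ≤ ·) (σ : Set P)}
  nonempty_of_mem h := h.1
  down_closed := by
    intro σ τ hσ hsub hne
    exact ⟨hne, hσ.2.mono (Finset.coe_subset.mpr hsub)⟩

/-- the `n`-fold ordered cartesian product `K^n` of an ordered simplicial complex. -/
def powC {V : Type u} [PartialOrder V] (K : ASC V) (n : ℕ) : ASC (Fin n → V) where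
  faces := {S | S.Nonempty ∧ IsChain (· ≤ ·) (S : Set (Fin n → V)) ∧
    ∀ j, S.image (fun x => x j) ∈ K.faces}
  nonempty_of_mem h := h.1
  down_closed := by
    intro S T hS hsub hne
    refine ⟨hne, hS.2.1.mono (Finset.coe_subset.mpr hsub), fun j => ?_⟩
    exact K.down_closed (hS.2.2 j) (Finset.image_subset_image hsub) (hne.image _)

/-- The Alexandrov topology associated to a relation: open sets are the down-sets. -/
def lowTop (α : Type u) (le : α → α → Prop) : TopologicalSpace α where
  IsOpen U := ∀ a ∈ U, ∀ b, le b a → b ∈ U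
  isOpen_univ := fun _ _ _ _ => trivial
  isOpen_inter := fun U V hU hV a ha b hb => ⟨hU a ha.1 b hb, hV a ha.2 b hb⟩
  isOpen_sUnion := by
    intro S hS a ha b hb
    obtain ⟨U, hUS, haU⟩ := ha
    exact ⟨U, hUS, hS U hUS a haU b hb⟩

/-- product topology, with an explicitly given topology on the first factor. -/
def prodTop (P : Type u) (lp : TopologicalSpace P) (Y : Type v) [ty : TopologicalSpace Y] :
    TopologicalSpace (P × Y) := @instTopologicalSpaceProd P Y lp ty
/-! ### The finite "wedge of fences" poset `J_{n,m}` -/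

/-- `J_{n,m}`: `none` is the common basepoint `0`, `some (j, i)` is the point `(i+1)_j`
on the `j`-th fence. -/
abbrev JP (n m : ℕ) : Type := Option (Fin n × Fin m)

/-- the zigzag (fence) order on values `0,1,2,…`:  `e ≤ o` when `e` is even, `o` odd and
they are adjacent. -/
def fLE (a b : ℕ) : Prop := a = b ∨ (a % 2 = 0 ∧ b % 2 = 1 ∧ (b = a + 1 ∨ a = b + 1))

/-- the order relation on `J_{n,m}`. -/
def JLE {n m : ℕ} : JP n m → JP n m → Prop
  | none, none => True
  | none, some q => fLE 0 (q.2.1 + 1)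
  | some p, none => fLE (p.2.1 + 1) 0
  | some p, some q => p.1 = q.1 ∧ fLE (p.2.1 + 1) (q.2.1 + 1)

/-- the end point `m_j` of the `j`-th fence. -/
def endPt (n m : ℕ) (j : Fin n) : JP n m :=
  if h : 0 < m then some (j, ⟨m - 1, by omega⟩) else none

/-- the action of `Σ_n` on `J_{n,m}` permuting the fences. -/
def jAct {n m : ℕ} (g : Equiv.Perm (Fin n)) : JP n m → JP n m :=
  Option.map (fun p => (g p.1, p.2))

/-- order-preserving maps out of `J_{n,m}`. -/
def JMono {n m : ℕ} {P : Type u} [Preorder P] (γ : JP n m → P) : Prop :=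
  ∀ a b, JLE a b → γ a ≤ γ b

/-! ### Iterated barycentric subdivisions (concrete model) -/

/-- `SdT V r` is the `r`-fold iterated `Finset` of `V`: the potential vertices of the `r`-fold
barycentric subdivision. -/
def SdT (V : Type u) : ℕ → Type u
  | 0 => V
  | r + 1 => Finset (SdT V r)

/-- the order on `SdT`: the given relation at level `0`, inclusion at higher levels. -/
def SdLE (V : Type u) (le0 : V → V → Prop) : (r : ℕ) → SdT V r → SdT V r → Prop
  | 0 => le0
  | r + 1 => fun (a b : Finset (SdT V r)) => a ⊆ b

/-- elements of `SdT V r` which are genuine iterated chains, i.e. points of `sd^r`. -/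
def SdOK (V : Type u) (le0 : V → V → Prop) : (r : ℕ) → SdT V r → Prop
  | 0 => fun _ => True
  | r + 1 => fun (c : Finset (SdT V r)) =>
      c.Nonempty ∧ (∀ x ∈ c, SdOK V le0 r x) ∧
      ∀ x ∈ c, ∀ y ∈ c, SdLE V le0 r x y ∨ SdLE V le0 r y x

/-- functorial lift of a self map to iterated subdivisions. -/
def SdMap (V : Type u) (f : V → V) : (r : ℕ) → SdT V r → SdT V r
  | 0 => f
  | r + 1 => fun (c : Finset (SdT V r)) => c.image (SdMap V f r)

instance sdNonempty (V : Type u) [Nonempty V] : ∀ r, Nonempty (SdT V r)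
  | 0 => ‹Nonempty V›
  | r + 1 => ⟨(∅ : Finset (SdT V r))⟩

instance sdFintype (V : Type u) [Fintype V] : ∀ r, Fintype (SdT V r)
  | 0 => ‹Fintype V›
  | r + 1 => letI := sdFintype V r; inferInstanceAs (Fintype (Finset (SdT V r)))

/-- the greatest element of a finite set w.r.t. a relation (junk value if there is none). -/
def grIn {α : Type u} [Nonempty α] (le : α → α → Prop) (c : Finset α) : α :=
  if h : ∃ x, x ∈ c ∧ ∀ y ∈ c, le y x then h.choose else Classical.arbitrary α

/-- the iterated "last element" map `τ^r : sd^r(P) → P`. -/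
def SdTau (V : Type u) [Nonempty V] (le0 : V → V → Prop) : (r : ℕ) → SdT V r → V
  | 0 => fun x => x
  | r + 1 => fun (c : Finset (SdT V r)) => SdTau V le0 r (grIn (SdLE V le0 r) c)

/-- the permutation action on `P^n`. -/
def pAct {X : Type u} {n : ℕ} (g : Equiv.Perm (Fin n)) (x : Fin n → X) : Fin n → X :=
  fun j => x (g j)

/-- open subsets of `sd^r` (in its Alexandrov topology), as sets of iterated chains. -/
def SdOpen (X : Type u) (le0 : X → X → Prop) (r : ℕ) (U : Set (SdT X r)) : Prop :=
  (∀ x ∈ U, SdOK X le0 r x) ∧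
  ∀ a ∈ U, ∀ b, SdOK X le0 r b → SdLE X le0 r b a → b ∈ U

/-! ### Higher symmetric combinatorial complexity -/

/-- `CC^{Σ,r}_{n,m}(P) ≤ k`. -/
def CCle (P : Type u) [PartialOrder P] [Nonempty P] (n m r k : ℕ) : Prop :=
  ∃ U : Fin k → Set (SdT (Fin n → P) r),
    (∀ i, SdOpen (Fin n → P) (· ≤ ·) r (U i)) ∧
    (∀ x, SdOK (Fin n → P) (· ≤ ·) r x → ∃ i, x ∈ U i) ∧
    (∀ i (g : Equiv.Perm (Fin n)), ∀ x ∈ U i, SdMap (Fin n → P) (pAct g) r x ∈ U i) ∧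
    (∀ i, ∃ s : SdT (Fin n → P) r → JP n m → P,
      (∀ x ∈ U i, JMono (s x)) ∧
      (∀ x ∈ U i, ∀ y ∈ U i, SdLE (Fin n → P) (· ≤ ·) r x y → ∀ t, s x t ≤ s y t) ∧
      (∀ (g : Equiv.Perm (Fin n)), ∀ x ∈ U i, ∀ t, s (SdMap (Fin n → P) (pAct g) r x) t = s x (jAct g t)) ∧
      (∀ x ∈ U i, ∀ j : Fin n, s x (endPt n m j) = SdTau (Fin n → P) (· ≤ ·) r x j))

/-- the value `CC^{Σ,r}_{n,m}(P)` (`∞` if there is no such cover). -/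
def CCnm (P : Type u) [PartialOrder P] [Nonempty P] (n m r : ℕ) : ℕ∞ :=
  sInf {k : ℕ∞ | ∃ k0 : ℕ, k = (k0 : ℕ∞) ∧ CCle P n m r k0}

/-- the stable value `CC^{Σ,r}_n(P)` (minimum over all fence lengths `m`). -/
def CCr (P : Type u) [PartialOrder P] [Nonempty P] (n r : ℕ) : ℕ∞ :=
  sInf {k : ℕ∞ | ∃ k0 m : ℕ, k = (k0 : ℕ∞) ∧ CCle P n m r k0}
/-! ### Iterated barycentric subdivision of a simplicial complex, and `SC^{Σ,r}_n` -/

/-- the `r`-fold barycentric subdivision `sd^r(K)`. -/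
def CIter {V : Type u} (K : ASC V) : (r : ℕ) → ASC (SdT V r)
  | 0 => K
  | r + 1 => sdC (CIter K r)

/-- the iterated linear map `|sd^r K| → |K|`. -/
def iterReal (V : Type u) [Fintype V] : (r : ℕ) → (SdT V r → ℝ) → (V → ℝ)
  | 0 => fun α => α
  | r + 1 => fun (β : Finset (SdT V r) → ℝ) => iterReal V r (stepReal (SdT V r) β)

/-- composition of the chosen one-step approximations `ι : sd^{s+1} → sd^s`, giving
`ι^r : sd^r(K^n) → K^n`. -/
def compIota {V' : Type u} (ιs : (s : ℕ) → Finset (SdT V' s) → SdT V' s) :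
    (r : ℕ) → SdT V' r → V'
  | 0 => fun x => x
  | r + 1 => fun (x : Finset (SdT V' r)) => compIota ιs r (ιs r x)

/-- the family `ιs` consists, up to level `r`, of `Σ_n`-equivariant simplicial approximations
of the identity of `|K^n|`. -/
def GoodIota {V : Type u} [Fintype V] [PartialOrder V] (K : ASC V) (n r : ℕ)
    (ιs : (s : ℕ) → Finset (SdT (Fin n → V) s) → SdT (Fin n → V) s) : Prop :=
  ∀ s, s < r →
    IsSimplicialMap (CIter (powC K n) (s + 1)) (CIter (powC K n) s) (ιs s) ∧
    (∀ (v : SdT (Fin n → V) (s + 1)), ∀ α ∈ (CIter (powC K n) (s + 1)).star v,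
      stepReal (SdT (Fin n → V) s) α ∈ (CIter (powC K n) s).star (ιs s v)) ∧
    (∀ (g : Equiv.Perm (Fin n)) (σ : SdT (Fin n → V) (s + 1)),
      ιs s (SdMap (Fin n → V) (pAct g) (s + 1) σ) = SdMap (Fin n → V) (pAct g) s (ιs s σ))

/-- `SC^{Σ,r}_n(K) ≤ k` (with respect to the chosen approximations `ιs`). -/
def SCle {V : Type u} [Fintype V] [PartialOrder V] (K : ASC V) (n r : ℕ)
    (ιs : (s : ℕ) → Finset (SdT (Fin n → V) s) → SdT (Fin n → V) s) (k : ℕ) : Prop :=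
  ∃ L : Fin k → ASC (SdT (Fin n → V) r),
    (∀ i, (L i).faces ⊆ (CIter (powC K n) r).faces) ∧
    (∀ σ ∈ (CIter (powC K n) r).faces, ∃ i, σ ∈ (L i).faces) ∧
    (∀ i (g : Equiv.Perm (Fin n)), ∀ σ ∈ (L i).faces,
      σ.image (SdMap (Fin n → V) (pAct g) r) ∈ (L i).faces) ∧
    (∀ i, SymContiguousOn n (fun g => SdMap (Fin n → V) (pAct g) r) (L i) K
      (fun j x => compIota ιs r x j))

/-- the value `SC^{Σ,r}_n(K)` with respect to the chosen approximations `ιs`. -/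
def SCval {V : Type u} [Fintype V] [PartialOrder V] (K : ASC V) (n r : ℕ)
    (ιs : (s : ℕ) → Finset (SdT (Fin n → V) s) → SdT (Fin n → V) s) : ℕ∞ :=
  sInf {k : ℕ∞ | ∃ k0 : ℕ, k = (k0 : ℕ∞) ∧ SCle K n r ιs k0}

/-! ### Helpers for the proof -/

def Carr {V : Type u} [Fintype V] (σ : Finset V) (p : V → ℝ) : Prop :=
  (∀ v, 0 ≤ p v) ∧ ∑ v, p v = 1 ∧ ∀ v, p v ≠ 0 → v ∈ σ

lemma Carr.mem {V : Type u} [Fintype V] {K : ASC V} {σ : Finset V} {p : V → ℝ}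
    (h : Carr σ p) (hσ : σ ∈ K.faces) : p ∈ K.realization :=
  ⟨h.1, h.2.1, σ, hσ, h.2.2⟩

lemma Carr.comb {V : Type u} [Fintype V] {σ : Finset V} {p q : V → ℝ}
    (hp : Carr σ p) (hq : Carr σ q) {a : ℝ} (h0 : 0 ≤ a) (h1 : a ≤ 1) :
    Carr σ (p + a • (q - p)) := by
  have key : ∀ v, (p + a • (q - p)) v = (1 - a) * p v + a * q v := by
    intro v; simp; ring
  refine ⟨fun v => ?_, ?_, fun v hv => ?_⟩
  · rw [key]
    have := hp.1 v
    have := hq.1 v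
    have : 0 ≤ 1 - a := by linarith
    positivity
  · simp only [key, Finset.sum_add_distrib, ← Finset.mul_sum, hp.2.1, hq.2.1]; ring
  · by_contra hc
    apply hv
    have h1 : p v = 0 := by by_contra h; exact hc (hp.2.2 v h)
    have h2 : q v = 0 := by by_contra h; exact hc (hq.2.2 v h)
    rw [key, h1, h2]; ring

def plc (t : ℝ) : ℝ := max 0 (min 1 t)

def plPath {V : Type u} (P : ℕ → V → ℝ) (N : ℕ) (t : ℝ) : V → ℝ :=
  P 0 + ∑ i ∈ Finset.range N, plc (t - i) • (P (i + 1) - P i)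

lemma plPath_end {V : Type u} (P : ℕ → V → ℝ) (N : ℕ) (t : ℝ) (ht : (N : ℝ) ≤ t) :
    plPath P N t = P N := by
  have : ∀ i ∈ Finset.range N, plc (t - i) • (P (i + 1) - P i) = P (i + 1) - P i := by
    intro i hi
    have hi' : ((i + 1 : ℕ) : ℝ) ≤ N := by exact_mod_cast Finset.mem_range.1 hi
    push_cast at hi'
    have : plc (t - i) = 1 := by
      unfold plc
      rw [min_eq_left (by linarith)]; norm_num
    rw [this, one_smul]
  unfold plPath
  rw [Finset.sum_congr rfl this, Finset.sum_range_sub]; abel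

lemma plPath_zero {V : Type u} (P : ℕ → V → ℝ) (N : ℕ) : plPath P N 0 = P 0 := by
  unfold plPath
  rw [Finset.sum_eq_zero, add_zero]
  intro i hi
  have : plc (0 - i) = 0 := by
    unfold plc
    apply max_eq_left
    apply (min_le_right _ _).trans
    simp
  rw [this, zero_smul]

lemma plPath_mem {V : Type u} [Fintype V] (K : ASC V) (P : ℕ → V → ℝ) (N : ℕ)
    (h0 : P 0 ∈ K.realization)
    (h : ∀ i < N, ∃ σ ∈ K.faces, Carr σ (P i) ∧ Carr σ (P (i + 1)))
    (t : ℝ) (ht : t ≤ N) : plPath P N t ∈ K.realization := by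
  induction N with
  | zero => simpa [plPath] using h0
  | succ N ih =>
    have hs : plPath P (N + 1) t = plPath P N t + plc (t - N) • (P (N + 1) - P N) := by
      simp [plPath, Finset.sum_range_succ, add_assoc]
    rcases le_total t N with htN | htN
    · have : plc (t - N) = 0 := by
        unfold plc
        apply max_eq_left
        apply (min_le_right _ _).trans
        linarith
      rw [hs, this, zero_smul, add_zero]
      exact ih (fun i hi => h i (by omega)) htN
    · rw [hs, plPath_end P N t htN]
      obtain ⟨σ, hσ, h1, h2⟩ := h N (by omega)
      refine (h1.comb h2 ?_ ?_).mem hσ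
      · exact le_max_left _ _
      · exact max_le zero_le_one (min_le_left _ _)

lemma vol_cont {Y : Type*} [TopologicalSpace Y] {ι κ : Type*} (A : Finset ι) (hA : A.Nonempty)
    (B : Finset κ) (hB : B.Nonempty) (f : ι → Y → ℝ) (g : κ → Y → ℝ)
    (hf : ∀ i, Continuous (f i)) (hg : ∀ i, Continuous (g i)) :
    Continuous fun y => MeasureTheory.volume.real
      {t : ℝ | (∀ i ∈ A, f i y ≤ t) ∧ ∀ k ∈ B, t < g k y} := by
  have : ∀ y, {t : ℝ | (∀ i ∈ A, f i y ≤ t) ∧ ∀ k ∈ B, t < g k y} =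
      Set.Ico (A.sup' hA (f · y)) (B.inf' hB (g · y)) := by
    intro y; ext t; simp [Finset.sup'_le_iff, Finset.lt_inf'_iff]
  simp only [this, Real.volume_real_Ico]
  exact ((Continuous.finset_inf'_apply hB fun i _ => hg i).sub
    (Continuous.finset_sup'_apply hA fun i _ => hf i)).max continuous_const

/-! layers -/

def ellS {W : Type u} (α : W → ℝ) (σ : Finset W) : Set ℝ :=
  {t | 0 ≤ t ∧ ∀ v, v ∈ σ ↔ t < α v}

def ell {W : Type u} (α : W → ℝ) (σ : Finset W) : ℝ := MeasureTheory.volume.real (ellS α σ)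

lemma ell_nonneg {W : Type u} (α : W → ℝ) (σ : Finset W) : 0 ≤ ell α σ :=
  MeasureTheory.measureReal_nonneg

lemma ell_ne {W : Type u} {α : W → ℝ} {σ : Finset W} (h : ell α σ ≠ 0) :
    ∃ t, 0 ≤ t ∧ ∀ v, v ∈ σ ↔ t < α v := by
  by_contra hc
  apply h
  have : ellS α σ = ∅ := by
    ext t
    simp only [Set.mem_empty_iff_false, iff_false]
    exact fun ht => hc ⟨t, ht⟩
  simp [ell, this]

lemma ell_chain {W : Type u} {α : W → ℝ} {σ τ : Finset W} (h : ell α σ ≠ 0) (h' : ell α τ ≠ 0) :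
    σ ⊆ τ ∨ τ ⊆ σ := by
  obtain ⟨t, -, ht⟩ := ell_ne h
  obtain ⟨s, -, hs⟩ := ell_ne h'
  rcases le_total t s with hts | hts
  · right; intro v hv; rw [ht]; rw [hs] at hv; linarith
  · left; intro v hv; rw [hs]; rw [ht] at hv; linarith

lemma ell_supp {W : Type u} {α : W → ℝ} {σ : Finset W} (h : ell α σ ≠ 0) {v : W} (hv : v ∈ σ) :
    0 < α v := by
  obtain ⟨t, h0, ht⟩ := ell_ne h
  rw [ht] at hv; linarith

lemma ellS_eq {W : Type u} [Fintype W] (α : W → ℝ) (σ : Finset W) (hσ : σ.Nonempty) :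
    ellS α σ = {t : ℝ | (∀ i ∈ (Finset.univ : Finset W), (if i ∈ σ then 0 else max 0 (α i)) ≤ t) ∧
      ∀ k ∈ σ, t < α k} := by
  ext t
  simp only [ellS, Set.mem_ofPred_eq, Finset.mem_univ, true_imp_iff]
  constructor
  · rintro ⟨h0, h⟩
    refine ⟨fun i => ?_, fun k hk => (h k).1 hk⟩
    split_ifs with hi
    · exact h0
    · rw [h i, not_lt] at hi; exact max_le h0 hi
  · rintro ⟨h1, h2⟩
    refine ⟨?_, fun v => ⟨h2 v, fun hv => ?_⟩⟩
    · obtain ⟨v, hv⟩ := hσ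
      simpa [hv] using h1 v
    · by_contra hc
      have := h1 v
      rw [if_neg hc] at this
      have := le_max_right 0 (α v)
      linarith

lemma ell_cont {W : Type u} [Fintype W] (σ : Finset W) (hσ : σ.Nonempty) :
    Continuous fun α : W → ℝ => ell α σ := by
  simp only [ell, ellS_eq _ σ hσ]
  refine vol_cont (Y := W → ℝ) Finset.univ ⟨hσ.choose, Finset.mem_univ _⟩ σ hσ
    (fun i α => if i ∈ σ then 0 else max 0 (α i)) (fun k α => α k) (fun i => ?_) (fun k => ?_)
  · split_ifs <;> fun_prop
  · fun_prop

lemma ellS_meas {W : Type u} [Fintype W] (α : W → ℝ) (σ : Finset W) :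
    MeasurableSet (ellS α σ) := by
  unfold ellS
  have : {t : ℝ | 0 ≤ t ∧ ∀ v, v ∈ σ ↔ t < α v} =
      Set.Ici 0 ∩ ⋂ v, {t : ℝ | v ∈ σ ↔ t < α v} := by
    ext t; simp
  rw [this]
  refine measurableSet_Ici.inter (MeasurableSet.iInter fun v => ?_)
  by_cases h : v ∈ σ
  · simp only [h, true_iff]; exact measurableSet_Iio
  · simp only [h, false_iff, not_lt]; exact measurableSet_Ici

lemma sum_ell {W : Type u} [Fintype W] (α : W → ℝ) (v : W) (hα : 0 ≤ α v) :
    ∑ σ : Finset W, (if v ∈ σ then ell α σ else 0) = α v := by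
  rw [← Finset.sum_filter]
  unfold ell
  rw [← MeasureTheory.measureReal_biUnion_finset ?_ ?_ ?_]
  · have : (⋃ σ ∈ Finset.univ.filter (fun σ : Finset W => v ∈ σ), ellS α σ) = Set.Ico 0 (α v) := by
      ext t
      simp only [Set.mem_iUnion, Finset.mem_filter, Finset.mem_univ, true_and, Set.mem_Ico]
      constructor
      · rintro ⟨σ, hv, h0, h⟩
        exact ⟨h0, (h v).1 hv⟩
      · rintro ⟨h0, h⟩
        exact ⟨Finset.univ.filter (fun w => t < α w), by simpa using h, h0, by simp⟩
    rw [this, Real.volume_real_Ico]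
    simpa using hα
  · intro σ _ τ _ hne
    rw [Function.onFun, Set.disjoint_left]
    rintro t ⟨_, h⟩ ⟨_, h'⟩
    exact hne (Finset.ext fun w => (h w).trans (h' w).symm)
  · intro σ _; exact ellS_meas α σ
  · intro σ hσ
    have hv : v ∈ σ := by simpa using hσ
    have : ellS α σ ⊆ Set.Ico 0 (α v) := fun t ht => ⟨ht.1, (ht.2 v).1 hv⟩
    exact ((MeasureTheory.measure_mono this).trans_lt measure_Ico_lt_top).ne

lemma ell_equiv {W : Type u} {f : W → W} (hf : Function.Bijective f) {α α' : W → ℝ}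
    (h : ∀ w, α' (f w) = α w) (σ : Finset W) : ell α' (σ.image f) = ell α σ := by
  have : ellS α' (σ.image f) = ellS α σ := by
    ext t
    simp only [ellS, Set.mem_ofPred_eq]
    refine and_congr_right fun _ => ?_
    rw [hf.surjective.forall]
    refine forall_congr' fun w => ?_
    rw [h, Finset.mem_image]
    have : (∃ a ∈ σ, f a = f w) ↔ w ∈ σ :=
      ⟨fun ⟨a, ha, he⟩ => hf.injective he ▸ ha, fun hw => ⟨w, hw, rfl⟩⟩
    rw [this]
  rw [ell, this, ell]

def layer {W : Type u} (α : W → ℝ) (σ : Finset W) : ℝ := σ.card * ell α σ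

lemma layer_ne {W : Type u} {α : W → ℝ} {σ : Finset W} (h : layer α σ ≠ 0) :
    σ.Nonempty ∧ ell α σ ≠ 0 := by
  constructor
  · by_contra hc
    rw [Finset.not_nonempty_iff_eq_empty] at hc
    apply h; simp [layer, hc]
  · intro hc; apply h; simp [layer, hc]

lemma layer_cont {W : Type u} [Fintype W] : Continuous fun α : W → ℝ => layer α := by
  refine continuous_pi fun σ => ?_
  by_cases h : σ.Nonempty
  · exact continuous_const.mul (ell_cont σ h)
  · rw [Finset.not_nonempty_iff_eq_empty] at h
    simp only [layer, h]
    simp only [Finset.card_empty, Nat.cast_zero, zero_mul]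
    exact continuous_const

lemma layer_equiv {W : Type u} {f : W → W} (hf : Function.Bijective f) {α α' : W → ℝ}
    (h : ∀ w, α' (f w) = α w) (σ : Finset W) : layer α' (σ.image f) = layer α σ := by
  rw [layer, layer, ell_equiv hf h, Finset.card_image_of_injective _ hf.injective]

lemma step_layer {W : Type u} [Fintype W] (α : W → ℝ) (hα : ∀ w, 0 ≤ α w) :
    stepReal W (layer α) = α := by
  funext w
  rw [← sum_ell α w (hα w), stepReal]
  refine Finset.sum_congr rfl fun σ _ => ?_
  split_ifs with h
  · have : (σ.card : ℝ) ≠ 0 := by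
      exact_mod_cast (Finset.card_pos.2 ⟨w, h⟩).ne'
    rw [layer]; field_simp
  · simp

lemma layer_mem {W : Type u} [Fintype W] (C : ASC W) (α : W → ℝ) (h : α ∈ C.realization) :
    layer α ∈ (sdC C).realization := by
  obtain ⟨h0, h1, τ, hτ, hs⟩ := h
  have hsum : ∑ σ, layer α σ = 1 := by
    rw [← h1]
    have : ∀ σ : Finset W, layer α σ = ∑ v, (if v ∈ σ then ell α σ else 0) := by
      intro σ
      rw [← Finset.sum_filter]; simp [layer]
    simp only [this]
    rw [Finset.sum_comm]
    exact Finset.sum_congr rfl fun v _ => sum_ell α v (h0 v)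
  refine ⟨fun σ => mul_nonneg (Nat.cast_nonneg _) (ell_nonneg _ _), hsum,
    Finset.univ.filter (fun σ => layer α σ ≠ 0), ⟨?_, ?_, ?_⟩, ?_⟩
  · by_contra hc
    rw [Finset.not_nonempty_iff_eq_empty, Finset.filter_eq_empty_iff] at hc
    rw [Finset.sum_eq_zero] at hsum
    · norm_num at hsum
    · intro σ hσ; simpa using hc hσ
  · intro σ hσ
    obtain ⟨hne, he⟩ := layer_ne (Finset.mem_filter.1 hσ).2
    exact C.down_closed hτ (fun v hv => hs v (ell_supp he hv).ne') hne
  · intro σ hσ σ' hσ' _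
    exact ell_chain (layer_ne (Finset.mem_filter.1 hσ).2).2 (layer_ne (Finset.mem_filter.1 hσ').2).2
  · intro σ hσ; simpa using hσ

/-! retraction onto a neighbourhood of a subcomplex -/

def rho {W : Type u} [Fintype W] (L : ASC W) (α : W → ℝ) (v : W) : ℝ :=
  ∑ σ : Finset W, if v ∈ σ ∧ σ ∈ L.faces then ell α σ else 0

def mass {W : Type u} [Fintype W] (L : ASC W) (α : W → ℝ) : ℝ := ∑ v, rho L α v

def nrho {W : Type u} [Fintype W] (L : ASC W) (α : W → ℝ) (v : W) : ℝ := rho L α v / mass L α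

lemma rho_cont {W : Type u} [Fintype W] (L : ASC W) (v : W) :
    Continuous fun α : W → ℝ => rho L α v := by
  refine continuous_finsetSum _ fun σ _ => ?_
  split_ifs with h
  · exact ell_cont σ ⟨v, h.1⟩
  · exact continuous_const

lemma mass_cont {W : Type u} [Fintype W] (L : ASC W) : Continuous fun α : W → ℝ => mass L α :=
  continuous_finsetSum _ fun v _ => rho_cont L v

lemma rho_nonneg {W : Type u} [Fintype W] (L : ASC W) (α : W → ℝ) (v : W) : 0 ≤ rho L α v :=
  Finset.sum_nonneg fun σ _ => by split_ifs; exacts [ell_nonneg _ _, le_rfl]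

lemma rho_ne {W : Type u} [Fintype W] {L : ASC W} {α : W → ℝ} {v : W} (h : rho L α v ≠ 0) :
    ∃ σ ∈ L.faces, v ∈ σ ∧ ell α σ ≠ 0 := by
  obtain ⟨σ, -, hσ⟩ := Finset.exists_ne_zero_of_sum_ne_zero h
  split_ifs at hσ with hc
  · exact ⟨σ, hc.2, hc.1, hσ⟩
  · exact absurd rfl hσ

lemma nrho_carr {W : Type u} [Fintype W] (L : ASC W) (α : W → ℝ) (hm : 0 < mass L α) :
    ∃ σ ∈ L.faces, Carr σ (nrho L α) := by
  let F : Finset (Finset W) := Finset.univ.filter fun σ => σ ∈ L.faces ∧ ell α σ ≠ 0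
  have hF : F.Nonempty := by
    obtain ⟨v, -, hv⟩ := Finset.exists_ne_zero_of_sum_ne_zero hm.ne'
    obtain ⟨σ, h1, -, h2⟩ := rho_ne hv
    exact ⟨σ, by simp [F, h1, h2]⟩
  obtain ⟨σ, hσF, hmax⟩ := Finset.exists_max_image F Finset.card hF
  have hσ := (Finset.mem_filter.1 hσF).2
  refine ⟨σ, hσ.1, fun v => div_nonneg (rho_nonneg _ _ _) hm.le, ?_, fun v hv => ?_⟩
  · simp only [nrho, ← Finset.sum_div]
    exact div_self hm.ne'
  · have hv' : rho L α v ≠ 0 := fun h => hv (by simp [nrho, h])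
    obtain ⟨τ, h1, hvτ, h2⟩ := rho_ne hv'
    rcases ell_chain hσ.2 h2 with h | h
    · have := hmax τ (by simp [F, h1, h2])
      rw [Finset.eq_of_subset_of_card_le h this]; exact hvτ
    · exact h hvτ

lemma nrho_supp {W : Type u} [Fintype W] {L : ASC W} {α : W → ℝ} {v : W} (h : nrho L α v ≠ 0) :
    α v ≠ 0 := by
  have hv' : rho L α v ≠ 0 := fun h' => h (by simp [nrho, h'])
  obtain ⟨τ, h1, hvτ, h2⟩ := rho_ne hv'
  exact (ell_supp h2 hvτ).ne'

lemma mass_pos {W : Type u} [Fintype W] (L : ASC W) (α : W → ℝ) (h : α ∈ L.realization) :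
    0 < mass L α := by
  obtain ⟨h0, h1, τ, hτ, hs⟩ := h
  have : mass L α = 1 := by
    rw [← h1]
    refine Finset.sum_congr rfl fun v _ => ?_
    rw [← sum_ell α v (h0 v)]
    refine Finset.sum_congr rfl fun σ _ => ?_
    by_cases hv : v ∈ σ
    · by_cases he : ell α σ = 0
      · simp [he]
      · have : σ ∈ L.faces := L.down_closed hτ (fun v hv => hs v (ell_supp he hv).ne') ⟨v, hv⟩
        simp [hv, this]
    · simp [hv]
  rw [this]; exact one_pos

lemma rho_equiv {W : Type u} [Fintype W] {f : W → W} (hf : Function.Bijective f) {L : ASC W}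
    (hL : ∀ σ : Finset W, σ.image f ∈ L.faces ↔ σ ∈ L.faces) {α α' : W → ℝ}
    (h : ∀ w, α' (f w) = α w) (v : W) : rho L α' (f v) = rho L α v := by
  have hb : Function.Bijective (fun σ : Finset W => σ.image f) :=
    Finite.injective_iff_bijective.1 (Finset.image_injective hf.injective)
  unfold rho
  rw [← hb.sum_comp]
  refine Finset.sum_congr rfl fun σ _ => ?_
  rw [ell_equiv hf h, hL]
  have : f v ∈ σ.image f ↔ v ∈ σ := by
    rw [Finset.mem_image]
    exact ⟨fun ⟨a, ha, he⟩ => hf.injective he ▸ ha, fun hw => ⟨v, hw, rfl⟩⟩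
  simp only [this]

lemma mass_equiv {W : Type u} [Fintype W] {f : W → W} (hf : Function.Bijective f) {L : ASC W}
    (hL : ∀ σ : Finset W, σ.image f ∈ L.faces ↔ σ ∈ L.faces) {α α' : W → ℝ}
    (h : ∀ w, α' (f w) = α w) : mass L α' = mass L α := by
  unfold mass
  rw [← hf.sum_comp]
  exact Finset.sum_congr rfl fun v _ => rho_equiv hf hL h v

lemma nrho_equiv {W : Type u} [Fintype W] {f : W → W} (hf : Function.Bijective f) {L : ASC W}
    (hL : ∀ σ : Finset W, σ.image f ∈ L.faces ↔ σ ∈ L.faces) {α α' : W → ℝ}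
    (h : ∀ w, α' (f w) = α w) (v : W) : nrho L α' (f v) = nrho L α v := by
  rw [nrho, nrho, rho_equiv hf hL h, mass_equiv hf hL h]

/-! realization of maps -/

lemma realizeMap_carr {V : Type u} {W : Type v} [Fintype V] [Fintype W] (f : V → W)
    {σ : Finset V} {β : V → ℝ} (h : Carr σ β) {τ : Finset W}
    (hτ : ∀ v ∈ σ, β v ≠ 0 → f v ∈ τ) : Carr τ (realizeMap f β) := by
  refine ⟨fun w => Finset.sum_nonneg fun v _ => h.1 v, ?_, fun w hw => ?_⟩
  · rw [← h.2.1]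
    unfold realizeMap
    exact Finset.sum_fiberwise _ _ _
  · obtain ⟨v, hv, hne⟩ := Finset.exists_ne_zero_of_sum_ne_zero hw
    rw [← (Finset.mem_filter.1 hv).2]
    exact hτ v (h.2.2 v hne) hne

lemma realizeMap_cont {V : Type u} {W : Type v} [Fintype V] (f : V → W) :
    Continuous fun β : V → ℝ => realizeMap f β :=
  continuous_pi fun _ => continuous_finsetSum _ fun v _ => continuous_apply v

lemma realizeMap_equiv {V : Type u} {W : Type v} [Fintype V] {a : V → V}
    (ha : Function.Bijective a) (f f' : V → W) {β β' : V → ℝ} (h : ∀ v, β' (a v) = β v)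
    (hf : ∀ v, β v ≠ 0 → f (a v) = f' v) : realizeMap f β' = realizeMap f' β := by
  funext w
  unfold realizeMap
  rw [Finset.sum_filter, Finset.sum_filter, ← ha.sum_comp]
  refine Finset.sum_congr rfl fun v _ => ?_
  rw [h]
  by_cases hv : β v = 0
  · simp [hv]
  · rw [hf v hv]

/-! the monotone coupling `|K|^n → |K^n|` -/

def Flo {V : Type u} [Fintype V] [PartialOrder V] (x : V → ℝ) (v : V) : ℝ :=
  ∑ u ∈ Finset.univ.filter (fun u => u < v), x u

def Fhi {V : Type u} [Fintype V] [PartialOrder V] (x : V → ℝ) (v : V) : ℝ := Flo x v + x v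

lemma Fhi_eq {V : Type u} [Fintype V] [PartialOrder V] (x : V → ℝ) (v : V) :
    Fhi x v = ∑ u ∈ Finset.univ.filter (fun u => u ≤ v), x u := by
  have : Finset.univ.filter (fun u => u ≤ v) =
      insert v (Finset.univ.filter (fun u => u < v)) := by
    ext u; simp [le_iff_eq_or_lt]
  rw [this, Finset.sum_insert (by simp), Fhi, Flo, add_comm]

lemma Fhi_le_Flo {V : Type u} [Fintype V] [PartialOrder V] {x : V → ℝ} (h0 : ∀ v, 0 ≤ x v)
    {u v : V} (h : u < v) : Fhi x u ≤ Flo x v := by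
  rw [Fhi_eq, Flo]
  apply Finset.sum_le_sum_of_subset_of_nonneg
  · intro w hw
    simp only [Finset.mem_filter, Finset.mem_univ, true_and] at hw ⊢
    exact hw.trans_lt h
  · intro i _ _; exact h0 i

lemma exists_top {V : Type u} [Fintype V] [PartialOrder V] {x : V → ℝ} (h0 : ∀ v, 0 ≤ x v)
    (hc : ∀ u v, x u ≠ 0 → x v ≠ 0 → u ≤ v ∨ v ≤ u) (D : Finset V) (hD : 0 < ∑ v ∈ D, x v) :
    ∃ u ∈ D, x u ≠ 0 ∧ ∑ v ∈ D, x v ≤ Fhi x u := by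
  have hne : (D.filter fun v => x v ≠ 0).Nonempty := by
    obtain ⟨v, hv, h⟩ := Finset.exists_ne_zero_of_sum_ne_zero hD.ne'
    exact ⟨v, by simp [hv, h]⟩
  obtain ⟨u, hu⟩ := Finset.exists_maximal hne
  have hu1 := Finset.mem_filter.1 hu.1
  refine ⟨u, hu1.1, hu1.2, ?_⟩
  rw [Fhi_eq, ← Finset.sum_filter_ne_zero]
  apply Finset.sum_le_sum_of_subset_of_nonneg
  · intro w hw
    have hw' := Finset.mem_filter.1 hw
    simp only [Finset.mem_filter, Finset.mem_univ, true_and]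
    rcases hc w u hw'.2 hu1.2 with h | h
    · exact h
    · exact hu.2 hw h
  · intro i _ _; exact h0 i

lemma exists_quantile {V : Type u} [Fintype V] [PartialOrder V] {x : V → ℝ} (h0 : ∀ v, 0 ≤ x v)
    (hc : ∀ u v, x u ≠ 0 → x v ≠ 0 → u ≤ v ∨ v ≤ u) (h1 : ∑ v, x v = 1) {t : ℝ}
    (ht0 : 0 ≤ t) (ht1 : t < 1) : ∃ v, Flo x v ≤ t ∧ t < Fhi x v := by
  have hne : (Finset.univ.filter fun v => x v ≠ 0 ∧ t < Fhi x v).Nonempty := by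
    obtain ⟨u, -, hu, h⟩ := exists_top h0 hc Finset.univ (by rw [h1]; exact one_pos)
    exact ⟨u, by simp only [Finset.mem_filter, Finset.mem_univ, true_and]; exact ⟨hu, by linarith⟩⟩
  obtain ⟨v, hv⟩ := Finset.exists_minimal hne
  have hv1 := (Finset.mem_filter.1 hv.1).2
  refine ⟨v, ?_, hv1.2⟩
  by_contra hlt
  push Not at hlt
  obtain ⟨u, hu, hux, h⟩ := exists_top h0 hc (Finset.univ.filter (fun u => u < v))
    (ht0.trans_lt hlt)
  have huv : u < v := by simpa using hu
  have : v ≤ u := hv.2 (by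
    simp only [Finset.mem_filter, Finset.mem_univ, true_and]
    exact ⟨hux, hlt.trans_le h⟩) huv.le
  exact absurd huv (not_lt_of_ge this)

lemma quantile_mono {V : Type u} [Fintype V] [PartialOrder V] {x : V → ℝ} (h0 : ∀ v, 0 ≤ x v)
    (hc : ∀ u v, x u ≠ 0 → x v ≠ 0 → u ≤ v ∨ v ≤ u) {t t' : ℝ} (htt : t ≤ t') {u v : V}
    (hu : Flo x u ≤ t ∧ t < Fhi x u) (hv : Flo x v ≤ t' ∧ t' < Fhi x v) : u ≤ v := by
  have hu0 : x u ≠ 0 := by intro h; rw [Fhi, h] at hu; linarith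
  have hv0 : x v ≠ 0 := by intro h; rw [Fhi, h] at hv; linarith
  rcases hc u v hu0 hv0 with h | h
  · exact h
  · rcases h.eq_or_lt with h | h
    · exact h.ge
    · have := Fhi_le_Flo h0 h
      linarith

def cplS {V : Type u} [Fintype V] [PartialOrder V] {n : ℕ} (x : Fin n → V → ℝ) (w : Fin n → V) :
    Set ℝ := {t | ∀ j, Flo (x j) (w j) ≤ t ∧ t < Fhi (x j) (w j)}

def cpl {V : Type u} [Fintype V] [PartialOrder V] {n : ℕ} (x : Fin n → V → ℝ) (w : Fin n → V) :
    ℝ := MeasureTheory.volume.real (cplS x w)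

lemma cpl_ne {V : Type u} [Fintype V] [PartialOrder V] {n : ℕ} {x : Fin n → V → ℝ}
    {w : Fin n → V} (h : cpl x w ≠ 0) : ∃ t, ∀ j, Flo (x j) (w j) ≤ t ∧ t < Fhi (x j) (w j) := by
  by_contra hc
  apply h
  have : cplS x w = ∅ := by
    ext t
    simp only [Set.mem_empty_iff_false, iff_false]
    exact fun ht => hc ⟨t, ht⟩
  simp [cpl, this]

lemma cpl_supp {V : Type u} [Fintype V] [PartialOrder V] {n : ℕ} {x : Fin n → V → ℝ}
    {w : Fin n → V} (h : cpl x w ≠ 0) (j : Fin n) : x j (w j) ≠ 0 := by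
  obtain ⟨t, ht⟩ := cpl_ne h
  intro h0
  have := ht j
  rw [Fhi, h0] at this
  linarith

lemma cpl_equiv {V : Type u} [Fintype V] [PartialOrder V] {n : ℕ} (x : Fin n → V → ℝ)
    (g : Equiv.Perm (Fin n)) (w : Fin n → V) :
    cpl (fun j => x (g j)) (pAct g w) = cpl x w := by
  have : cplS (fun j => x (g j)) (pAct g w) = cplS x w := by
    ext t
    exact (g.surjective.forall (p := fun j => Flo (x j) (w j) ≤ t ∧ t < Fhi (x j) (w j))).symm
  rw [cpl, this, cpl]

lemma cplS_eq {V : Type u} [Fintype V] [PartialOrder V] {n : ℕ} (x : Fin n → V → ℝ)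
    (w : Fin n → V) : cplS x w = {t | (∀ j ∈ (Finset.univ : Finset (Fin n)), Flo (x j) (w j) ≤ t) ∧
      ∀ j ∈ (Finset.univ : Finset (Fin n)), t < Fhi (x j) (w j)} := by
  ext t; simp [cplS, forall_and]

lemma Flo_cont {V : Type u} [Fintype V] [PartialOrder V] (v : V) :
    Continuous fun x : V → ℝ => Flo x v :=
  continuous_finsetSum _ fun u _ => continuous_apply u

lemma cpl_cont {V : Type u} [Fintype V] [PartialOrder V] {n : ℕ} (hn : 0 < n) :
    Continuous fun x : Fin n → V → ℝ => cpl x := by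
  refine continuous_pi fun w => ?_
  simp only [cpl, cplS_eq]
  refine vol_cont (Y := Fin n → V → ℝ) Finset.univ ⟨⟨0, hn⟩, Finset.mem_univ _⟩ Finset.univ
    ⟨⟨0, hn⟩, Finset.mem_univ _⟩ (fun j x => Flo (x j) (w j)) (fun j x => Fhi (x j) (w j))
    (fun j => (Flo_cont (w j)).comp (continuous_apply j)) (fun j => ?_)
  exact ((Flo_cont (w j)).comp (continuous_apply j)).add
    ((continuous_apply (w j)).comp (continuous_apply j))

lemma cpl_mem {V : Type u} [Fintype V] [PartialOrder V] {n : ℕ} (hn : 0 < n) (K : ASC V)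
    (hord : ∀ σ ∈ K.faces, IsChain (· ≤ ·) (σ : Set V)) (x : Fin n → V → ℝ)
    (hx : ∀ j, x j ∈ K.realization) : cpl x ∈ (powC K n).realization := by
  have h0 : ∀ j v, 0 ≤ x j v := fun j => (hx j).1
  have hc : ∀ j u v, x j u ≠ 0 → x j v ≠ 0 → u ≤ v ∨ v ≤ u := by
    intro j u v hu hv
    obtain ⟨σ, hσ, hs⟩ := (hx j).2.2
    exact (hord σ hσ).total (hs u hu) (hs v hv)
  have hsub : ∀ w, cplS x w ⊆ Set.Ico 0 1 := by
    intro w t ht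
    have h := ht ⟨0, hn⟩
    refine ⟨le_trans (Finset.sum_nonneg fun u _ => h0 _ u) h.1, h.2.trans_le ?_⟩
    rw [Fhi_eq, ← (hx ⟨0, hn⟩).2.1]
    exact Finset.sum_le_sum_of_subset_of_nonneg (Finset.subset_univ _) fun i _ _ => h0 _ i
  have hsum : ∑ w, cpl x w = 1 := by
    unfold cpl
    rw [← MeasureTheory.measureReal_biUnion_finset ?_ ?_ ?_]
    · have : (⋃ w ∈ (Finset.univ : Finset (Fin n → V)), cplS x w) = Set.Ico 0 1 := by
        ext t
        simp only [Set.mem_iUnion, Finset.mem_univ, exists_prop, true_and]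
        constructor
        · rintro ⟨w, hw⟩; exact hsub w hw
        · rintro ⟨ht0, ht1⟩
          choose w hw using fun j => exists_quantile (h0 j) (hc j) (hx j).2.1 ht0 ht1
          exact ⟨w, hw⟩
      rw [this, Real.volume_real_Ico]; norm_num
    · intro w _ w' _ hne
      rw [Function.onFun, Set.disjoint_left]
      intro t ht ht'
      exact hne (funext fun j => le_antisymm (quantile_mono (h0 j) (hc j) le_rfl (ht j) (ht' j))
        (quantile_mono (h0 j) (hc j) le_rfl (ht' j) (ht j)))
    · intro w _
      have : cplS x w = ⋂ j, Set.Ico (Flo (x j) (w j)) (Fhi (x j) (w j)) := by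
        ext t; simp [cplS]
      rw [this]
      exact MeasurableSet.iInter fun j => measurableSet_Ico
    · intro w _
      exact ((MeasureTheory.measure_mono (hsub w)).trans_lt measure_Ico_lt_top).ne
  have hne : (Finset.univ.filter fun w => cpl x w ≠ 0).Nonempty := by
    obtain ⟨w, -, hw⟩ := Finset.exists_ne_zero_of_sum_ne_zero (hsum.trans_ne one_ne_zero)
    exact ⟨w, by simpa using hw⟩
  refine ⟨fun w => MeasureTheory.measureReal_nonneg, hsum,
    Finset.univ.filter (fun w => cpl x w ≠ 0), ⟨hne, ?_, fun j => ?_⟩, fun w hw => by simpa using hw⟩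
  · intro w hw w' hw' _
    obtain ⟨t, ht⟩ := cpl_ne (Finset.mem_filter.1 hw).2
    obtain ⟨t', ht'⟩ := cpl_ne (Finset.mem_filter.1 hw').2
    rcases le_total t t' with h | h
    · exact Or.inl fun j => quantile_mono (h0 j) (hc j) h (ht j) (ht' j)
    · exact Or.inr fun j => quantile_mono (h0 j) (hc j) h (ht' j) (ht j)
  · obtain ⟨σ, hσ, hs⟩ := (hx j).2.2
    refine K.down_closed hσ ?_ (hne.image _)
    intro v hv
    obtain ⟨w, hw, rfl⟩ := Finset.mem_image.1 hv
    exact hs _ (cpl_supp (Finset.mem_filter.1 hw).2 j)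

/-! iterated subdivision -/

def secReal (W : Type u) [Fintype W] : (r : ℕ) → (W → ℝ) → (SdT W r → ℝ)
  | 0 => fun α => α
  | r + 1 => fun α => layer (secReal W r α)

lemma secReal_mem {W : Type u} [Fintype W] (C : ASC W) (α : W → ℝ) (h : α ∈ C.realization) :
    ∀ r, secReal W r α ∈ (CIter C r).realization
  | 0 => h
  | r + 1 => layer_mem (CIter C r) _ (secReal_mem C α h r)

lemma secReal_cont {W : Type u} [Fintype W] : ∀ r, Continuous fun α : W → ℝ => secReal W r α
  | 0 => continuous_id
  | r + 1 => (layer_cont (W := SdT W r)).comp (secReal_cont r)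

lemma SdMap_id_of {W : Type u} {f g : W → W} (h : ∀ w, f (g w) = w) :
    ∀ r (x : SdT W r), SdMap W f r (SdMap W g r x) = x
  | 0 => h
  | r + 1 => fun (x : Finset (SdT W r)) => by
    change (x.image (SdMap W g r)).image (SdMap W f r) = x
    rw [Finset.image_image]
    have : SdMap W f r ∘ SdMap W g r = id := funext (SdMap_id_of h r)
    rw [this, Finset.image_id]

lemma pAct_inv {X : Type u} {n : ℕ} (g : Equiv.Perm (Fin n)) (x : Fin n → X) :
    pAct g⁻¹ (pAct g x) = x := by
  funext j; simp [pAct]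

lemma pAct_inv' {X : Type u} {n : ℕ} (g : Equiv.Perm (Fin n)) (x : Fin n → X) :
    pAct g (pAct g⁻¹ x) = x := by
  funext j; simp [pAct]

lemma SdMap_bij {X : Type u} {n : ℕ} (g : Equiv.Perm (Fin n)) (r : ℕ) :
    Function.Bijective (SdMap (Fin n → X) (pAct g) r) :=
  ⟨(show Function.LeftInverse (SdMap (Fin n → X) (pAct g⁻¹) r) _ from
      SdMap_id_of (pAct_inv g) r).injective,
   (show Function.RightInverse (SdMap (Fin n → X) (pAct g⁻¹) r) _ from
      SdMap_id_of (pAct_inv' g) r).surjective⟩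

lemma secReal_equiv {X : Type u} [Fintype X] {n : ℕ} (g : Equiv.Perm (Fin n))
    {α α' : (Fin n → X) → ℝ} (h : ∀ w, α' (pAct g w) = α w) :
    ∀ r (σ : SdT (Fin n → X) r),
      secReal (Fin n → X) r α' (SdMap (Fin n → X) (pAct g) r σ) = secReal (Fin n → X) r α σ
  | 0 => h
  | r + 1 => fun (σ : Finset (SdT (Fin n → X) r)) =>
    layer_equiv (SdMap_bij g r) (secReal_equiv g h r) σ

lemma secReal_iota {V : Type u} [Fintype V] [PartialOrder V] (K : ASC V) (n : ℕ)
    (ιs : (s : ℕ) → Finset (SdT (Fin n → V) s) → SdT (Fin n → V) s)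
    (α : (Fin n → V) → ℝ) (hα : α ∈ (powC K n).realization) :
    ∀ r, GoodIota K n r ιs → ∀ v : SdT (Fin n → V) r, secReal (Fin n → V) r α v ≠ 0 →
      α (compIota ιs r v) ≠ 0
  | 0, _, v, hv => hv
  | r + 1, hι, v, hv => by
    have h1 := (hι r (by omega)).2.1 v (secReal (Fin n → V) (r + 1) α)
      ⟨secReal_mem (powC K n) α hα (r + 1), hv⟩
    have h2 : stepReal (SdT (Fin n → V) r) (secReal (Fin n → V) (r + 1) α) =
        secReal (Fin n → V) r α := step_layer _ (secReal_mem (powC K n) α hα r).1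
    rw [h2] at h1
    exact secReal_iota K n ιs α hα r (fun s hs => hι s (by omega)) (ιs r v) h1.2

lemma realization_compact {V : Type u} [Fintype V] (K : ASC V) : IsCompact K.realization := by
  have hc : IsClosed K.realization := by
    have : K.realization = ⋃ σ ∈ K.faces, {α : V → ℝ | Carr σ α} := by
      ext α
      simp only [ASC.realization, Carr, Set.mem_ofPred_eq, Set.mem_iUnion, exists_prop]
      tauto
    rw [this]
    refine Set.Finite.isClosed_biUnion (Set.toFinite _) fun σ _ => ?_
    have : {α : V → ℝ | Carr σ α} = (⋂ v, {α : V → ℝ | 0 ≤ α v}) ∩ {α | ∑ v, α v = 1} ∩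
        ⋂ v, {α | α v ≠ 0 → v ∈ σ} := by
      ext α; simp [Carr, and_assoc]
    rw [this]
    refine ((isClosed_iInter fun v => isClosed_le continuous_const (continuous_apply v)).inter
      (isClosed_eq (by fun_prop) continuous_const)).inter (isClosed_iInter fun v => ?_)
    by_cases h : v ∈ σ
    · simp [h]
    · simp only [h, imp_false, not_not]
      exact isClosed_eq (continuous_apply v) continuous_const
  refine (isCompact_univ_pi (fun _ : V => isCompact_Icc (a := (0 : ℝ)) (b := 1))).of_isClosed_subset
    hc ?_
  intro α hα v _
  refine ⟨hα.1 v, ?_⟩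
  rw [← hα.2.1]
  exact Finset.single_le_sum (fun i _ => hα.1 i) (Finset.mem_univ v)

lemma wedge_section {Y : Type u} {X : Type v} [TopologicalSpace Y] [TopologicalSpace X]
    [LocallyCompactSpace Y] {n : ℕ} (H : Y → Fin n → unitInterval → X)
    (hcont : ∀ j, Continuous fun p : Y × unitInterval => H p.1 j p.2)
    (h0 : ∀ y j j', H y j 0 = H y j' 0) :
    ∃ s : C(Y, C(WedgeI n, X)), ∀ y j t, s y (arm n j t) = H y j t := by
  let q : Fin n × unitInterval → WedgeI n := fun p => Quotient.mk (wedgeSetoid n) p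
  have hq : Topology.IsQuotientMap q := isQuotientMap_quot_mk
  let G : Y × WedgeI n → X := fun p => Quotient.lift (s := wedgeSetoid n)
    (fun a : Fin n × unitInterval => H p.1 a.1 a.2) (by
      rintro ⟨a, s⟩ ⟨b, t⟩ (h | ⟨h1, h2⟩)
      · simp only [Prod.mk.injEq] at h
        obtain ⟨rfl, rfl⟩ := h
        rfl
      · simp only at h1 h2
        subst h1 h2
        exact h0 _ _ _) p.2
  have hG : Continuous G := by
    refine hq.continuous_lift_prod_right ?_
    change Continuous fun p : Y × (Fin n × unitInterval) => H p.1 p.2.1 p.2.2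
    have : Continuous fun p : Fin n × (Y × unitInterval) => H p.2.1 p.1 p.2.2 :=
      continuous_prod_of_discrete_left.2 hcont
    exact this.comp (by fun_prop :
      Continuous fun p : Y × (Fin n × unitInterval) => (p.2.1, (p.1, p.2.2)))
  exact ⟨ContinuousMap.curry ⟨G, hG⟩, fun y j t => rfl⟩

/-- the point of `|sd^r(K^n)|` corresponding to a point of `|K|^n`. -/
def toSd {V : Type u} [Fintype V] [PartialOrder V] (K : ASC V) (n r : ℕ)
    (x : Fin n → ↥(K.realization)) : SdT (Fin n → V) r → ℝ :=
  secReal (Fin n → V) r (cpl fun j => (x j).1)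

lemma toSd_cont {V : Type u} [Fintype V] [PartialOrder V] (K : ASC V) (n r : ℕ) (hn : 0 < n) :
    Continuous (toSd K n r) :=
  (secReal_cont r).comp ((cpl_cont hn).comp
    (continuous_pi fun j => continuous_subtype_val.comp (continuous_apply j)))

lemma toSd_equiv {V : Type u} [Fintype V] [PartialOrder V] (K : ASC V) (n r : ℕ)
    (g : Equiv.Perm (Fin n)) (x : Fin n → ↥(K.realization)) (σ : SdT (Fin n → V) r) :
    toSd K n r (fun j => x (g j)) (SdMap (Fin n → V) (pAct g) r σ) = toSd K n r x σ :=
  secReal_equiv g (fun w => cpl_equiv (fun j => (x j).1) g w) r σ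

/-- the vertices of the broken line from the common point to `x j`. -/
def ptSeq {V : Type u} [Fintype V] [PartialOrder V] (K : ASC V) (n r : ℕ)
    (L : ASC (SdT (Fin n → V) r)) (c : ℕ) (φ : Fin n → ℕ → SdT (Fin n → V) r → V)
    (x : Fin n → ↥(K.realization)) (j : Fin n) (l : ℕ) : V → ℝ :=
  if l ≤ c then realizeMap (φ j l) (nrho L (toSd K n r x)) else (x j).1

/-- `TC^Σ_n(|K|) ≤ SC^{Σ,r}_n(K)` for every finite simplicial complex `K`. -/
theorem statement7 {V : Type*} [Fintype V] [PartialOrder V] (K : ASC V)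
    (hord : ∀ σ ∈ K.faces, IsChain (· ≤ ·) (σ : Set V))
    (n r : ℕ) (hn : 2 ≤ n)
    (ιs : (s : ℕ) → Finset (SdT (Fin n → V) s) → SdT (Fin n → V) s)
    (hι : GoodIota K n r ιs) :
    TCSigma n ↥(K.realization) ≤ SCval K n r ιs := by
  have hn0 : 0 < n := by omega
  have : CompactSpace ↥(K.realization) := isCompact_iff_compactSpace.1 (realization_compact K)
  refine le_sInf ?_
  rintro _ ⟨k, rfl, L, hLsub, hLcov, hLinv, hLsym⟩
  refine sInf_le ⟨k, rfl, fun i => {x | 0 < mass (L i) (toSd K n r x)}, ?_, ?_, ?_, ?_⟩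
  · intro i
    exact isOpen_lt continuous_const ((mass_cont (L i)).comp (toSd_cont K n r hn0))
  · intro x
    obtain ⟨h0, h1, σ, hσ, hs⟩ := secReal_mem (powC K n) _
      (cpl_mem hn0 K hord (fun j => (x j).1) (fun j => (x j).2)) r
    obtain ⟨i, hi⟩ := hLcov σ hσ
    exact ⟨i, mass_pos (L i) _ ⟨h0, h1, σ, hi, hs⟩⟩
  all_goals
    have hLiff : ∀ i (g : Equiv.Perm (Fin n)) (σ : Finset (SdT (Fin n → V) r)),
        σ.image (SdMap (Fin n → V) (pAct g) r) ∈ (L i).faces ↔ σ ∈ (L i).faces := by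
      intro i g σ
      refine ⟨fun h => ?_, hLinv i g σ⟩
      have h' := hLinv i g⁻¹ _ h
      rw [Finset.image_image] at h'
      have he : SdMap (Fin n → V) (pAct g⁻¹) r ∘ SdMap (Fin n → V) (pAct g) r = id :=
        funext (SdMap_id_of (pAct_inv g) r)
      rwa [he, Finset.image_id] at h'
  · intro i g x hx
    change 0 < mass (L i) (toSd K n r fun j => x (g j))
    rw [mass_equiv (SdMap_bij g r) (hLiff i g) (toSd_equiv K n r g x)]
    exact hx
  · intro i
    have hop : IsOpen {x | 0 < mass (L i) (toSd K n r x)} :=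
      isOpen_lt continuous_const ((mass_cont (L i)).comp (toSd_cont K n r hn0))
    have : LocallyCompactSpace ↥{x | 0 < mass (L i) (toSd K n r x)} := hop.locallyCompactSpace
    obtain ⟨-, c, φ, hc, hφ0, -, hφc, hφ1, hφe⟩ := hLsym i
    have hcarr : ∀ x, 0 < mass (L i) (toSd K n r x) → ∀ j, ∀ l < c + 1, ∃ σ ∈ K.faces,
        Carr σ (ptSeq K n r (L i) c φ x j l) ∧ Carr σ (ptSeq K n r (L i) c φ x j (l + 1)) := by
      intro x hx j l hl
      obtain ⟨σ, hσ, hβ⟩ := nrho_carr (L i) _ hx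
      rcases (Nat.lt_succ_iff.1 hl).lt_or_eq with hlc | rfl
      · refine ⟨_, (hφ1 j l hlc).2.2 σ hσ, ?_, ?_⟩
        · rw [ptSeq, if_pos hlc.le]
          exact realizeMap_carr _ hβ fun v hv _ =>
            Finset.mem_union_left _ (Finset.mem_image_of_mem _ hv)
        · rw [ptSeq, if_pos (show l + 1 ≤ c from hlc)]
          exact realizeMap_carr _ hβ fun v hv _ =>
            Finset.mem_union_right _ (Finset.mem_image_of_mem _ hv)
      · obtain ⟨h0, h1, τ, hτ, hs⟩ := (x j).2
        refine ⟨τ, hτ, ?_, ?_⟩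
        · rw [ptSeq, if_pos le_rfl, hφc]
          refine realizeMap_carr _ hβ fun v _ hv => hs _ ?_
          exact cpl_supp (secReal_iota K n ιs _
            (cpl_mem hn0 K hord (fun j => (x j).1) (fun j => (x j).2)) r hι v (nrho_supp hv)) j
        · rw [ptSeq, if_neg (by omega)]
          exact ⟨h0, h1, hs⟩
    have hmem : ∀ x, 0 < mass (L i) (toSd K n r x) → ∀ j (t : unitInterval),
        plPath (ptSeq K n r (L i) c φ x j) (c + 1) (((c + 1 : ℕ) : ℝ) * t) ∈ K.realization := by
      intro x hx j t
      obtain ⟨σ, hσ, h1, -⟩ := hcarr x hx j 0 (by omega)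
      refine plPath_mem K _ _ (h1.mem hσ) (hcarr x hx j) _ ?_
      exact mul_le_of_le_one_right (Nat.cast_nonneg _) t.2.2
    have heq : ∀ (g : Equiv.Perm (Fin n)) x, 0 < mass (L i) (toSd K n r x) → ∀ j l,
        ptSeq K n r (L i) c φ (fun j => x (g j)) j l = ptSeq K n r (L i) c φ x (g j) l := by
      intro g x hx j l
      unfold ptSeq
      split_ifs with hl
      · obtain ⟨σ, hσ, hβ⟩ := nrho_carr (L i) _ hx
        refine realizeMap_equiv (SdMap_bij g r) _ _
          (nrho_equiv (SdMap_bij g r) (hLiff i g) (toSd_equiv K n r g x)) fun v hv => ?_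
        refine hφe j l g v ((L i).down_closed hσ ?_ (Finset.singleton_nonempty v)) hl
        exact Finset.singleton_subset_iff.2 (hβ.2.2 v hv)
      · rfl
    let H : ↥{x | 0 < mass (L i) (toSd K n r x)} → Fin n → unitInterval → ↥(K.realization) :=
      fun x j t => ⟨_, hmem x.1 x.2 j t⟩
    have hHc : ∀ j, Continuous fun p : ↥{x | 0 < mass (L i) (toSd K n r x)} × unitInterval =>
        H p.1 j p.2 := by
      intro j
      refine Continuous.subtype_mk ?_ _
      have hpt : ∀ l, Continuous fun x : ↥{x | 0 < mass (L i) (toSd K n r x)} =>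
          ptSeq K n r (L i) c φ x.1 j l := by
        intro l
        unfold ptSeq
        split_ifs
        · refine (realizeMap_cont (φ j l)).comp (continuous_pi fun v => ?_)
          have h1 : Continuous fun x : ↥{x | 0 < mass (L i) (toSd K n r x)} => toSd K n r x.1 :=
            (toSd_cont K n r hn0).comp continuous_subtype_val
          exact ((rho_cont (L i) v).comp h1).div ((mass_cont (L i)).comp h1) fun x => x.2.ne'
        · exact continuous_subtype_val.comp ((continuous_apply j).comp continuous_subtype_val)
      unfold plPath
      refine ((hpt 0).comp continuous_fst).add ?_
      refine continuous_finsetSum _ fun l _ => ?_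
      have h2 : ∀ l, Continuous fun p : ↥{x | 0 < mass (L i) (toSd K n r x)} × unitInterval =>
          ptSeq K n r (L i) c φ p.1.1 j l := fun l => (hpt l).comp continuous_fst
      have h3 : Continuous fun p : ↥{x | 0 < mass (L i) (toSd K n r x)} × unitInterval =>
          plc (((c + 1 : ℕ) : ℝ) * (p.2 : ℝ) - (l : ℝ)) := by
        unfold plc
        fun_prop
      exact h3.smul ((h2 (l + 1)).sub (h2 l))
    have hH0 : ∀ y j j', H y j 0 = H y j' 0 := by
      intro x j j'
      apply Subtype.ext
      change plPath _ _ _ = plPath _ _ _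
      simp only [Set.Icc.coe_zero, mul_zero, plPath_zero]
      simp only [ptSeq, Nat.zero_le, if_true, hφ0 j j']
    obtain ⟨s, hs⟩ := wedge_section H hHc hH0
    refine ⟨s, fun x j => ?_, fun g x hx hgx t j => ?_⟩
    · rw [hs]
      apply Subtype.ext
      change plPath _ _ _ = _
      rw [plPath_end _ _ _ (by simp), ptSeq, if_neg (by omega)]
    · rw [hs, hs]
      apply Subtype.ext
      change plPath _ _ _ = plPath _ _ _
      rw [funext (heq g x hx j)]
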